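/- Let 0 < α < 3 and 2 < q ≤ 6 with q > 6 − 2α, let q′ = q/(q−1), let C > 0, and let Γ : ℝ³ → (0,∞) be measurable with Γ(x) ≤ C(1+|x|)^{−α} for almost every x. Then there exists a constant C′ > 0 depending only on C, α, q such that every measurable f : ℝ³ → ℝ³ with ∫ Γ^{1−q′}|f|^{q′} dx < ∞ belongs to L^{6/5}(ℝ³;ℝ³) and satisfies ‖f‖_{L^{6/5}} ≤ C′·(∫ Γ^{1−q′}|f|^{q′} dx)^{1/q′}. -/

import Mathlib

open Set MeasureTheory ENNReal

lemma exists_holder_exponent (α q q' C : ℝ) (hα0 : 0 < α)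
    (hq2 : 2 < q) (hq6 : q ≤ 6) (hqα : 6 - 2 * α < q)
    (hq' : q' = q / (q - 1)) (hC : 0 < C) :
    ∃ r : ℝ≥0∞, ENNReal.HolderTriple r (ENNReal.ofReal q') (ENNReal.ofReal (6 / 5)) ∧
      eLpNorm (fun x : EuclideanSpace ℝ (Fin 3) => (C * (1 + ‖x‖) ^ (-α)) ^ (1 / q)) r volume
        < ⊤ := by
  have hq0 : 0 < q := by linarith
  have hq1 : 0 < q - 1 := by linarith
  rcases eq_or_lt_of_le hq6 with h6 | h6
  · refine ⟨⊤, ⟨?_⟩, ?_⟩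
    · have : q' = 6 / 5 := by rw [hq', h6]; norm_num
      rw [this]; simp
    · rw [eLpNorm_exponent_top]
      refine eLpNormEssSup_lt_top_of_ae_bound (C := C ^ (1 / q)) (.of_forall fun x => ?_)
      · rw [Real.norm_of_nonneg (by positivity)]
        have : (1 + ‖x‖) ^ (-α) ≤ 1 :=
          Real.rpow_le_one_of_one_le_of_nonpos (by linarith [norm_nonneg x]) (by linarith)
        have h2 : C * (1 + ‖x‖) ^ (-α) ≤ C := by nlinarith
        gcongr
  · have hd : 0 < 6 - q := by linarith
    have hr : 0 < 6 * q / (6 - q) := by positivity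
    refine ⟨ENNReal.ofReal (6 * q / (6 - q)), ⟨?_⟩, ?_⟩
    · have hq'0 : 0 < q' := by rw [hq']; positivity
      rw [← ENNReal.ofReal_inv_of_pos hr, ← ENNReal.ofReal_inv_of_pos hq'0,
        ← ENNReal.ofReal_inv_of_pos (by norm_num), ← ENNReal.ofReal_add (by positivity) (by positivity)]
      congr 1
      rw [hq']
      field_simp
      ring
    · rw [eLpNorm_lt_top_iff_lintegral_rpow_enorm_lt_top (by simpa using hr) (by simp)]
      rw [ENNReal.toReal_ofReal hr.le]
      have hfin := finite_integral_one_add_norm (E := EuclideanSpace ℝ (Fin 3)) (μ := volume)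
        (r := 6 * α / (6 - q)) (by
          rw [finrank_euclideanSpace_fin, lt_div_iff₀ hd]; push_cast; linarith)
      have : ∀ x : EuclideanSpace ℝ (Fin 3),
          ‖(C * (1 + ‖x‖) ^ (-α)) ^ (1 / q)‖ₑ ^ (6 * q / (6 - q))
            = ENNReal.ofReal (C ^ (6 / (6 - q))) *
              ENNReal.ofReal ((1 + ‖x‖) ^ (-(6 * α / (6 - q)))) := by
        intro x
        have h1 : 0 < 1 + ‖x‖ := by positivity
        rw [Real.enorm_of_nonneg (by positivity), ENNReal.ofReal_rpow_of_nonneg (by positivity) hr.le,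
          ← ENNReal.ofReal_mul (by positivity), ← Real.rpow_mul (by positivity),
          Real.mul_rpow hC.le (by positivity), ← Real.rpow_mul h1.le]
        congr 3 <;> field_simp
      simp_rw [this]
      rw [lintegral_const_mul _ (by fun_prop)]
      exact ENNReal.mul_lt_top (by simp) hfin

/-- Weighted embedding into `L^{6/5}`: for `0 < α < 3`, `6 − 2α < q ≤ 6`, `2 < q`, with
conjugate exponent `q′`, and `Γ(x) ≤ C(1+|x|)^{−α}` a.e., there is `C′ > 0` depending
only on `C, α, q` such that every measurable `f : ℝ³ → ℝ³` with
`∫ Γ^{1−q′}|f|^{q′} < ∞` belongs to `L^{6/5}` and satisfies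
`‖f‖_{6/5} ≤ C′·(∫ Γ^{1−q′}|f|^{q′})^{1/q′}`. -/
theorem weighted_embedding_into_L65
    (α q q' C : ℝ) (hα0 : 0 < α) (hα3 : α < 3)
    (hq2 : 2 < q) (hq6 : q ≤ 6) (hqα : 6 - 2 * α < q)
    (hq' : q' = q / (q - 1)) (hC : 0 < C) :
    ∃ C' : ℝ, 0 < C' ∧
      ∀ Γ : EuclideanSpace ℝ (Fin 3) → ℝ,
        Measurable Γ → (∀ x, 0 < Γ x) →
        (∀ᵐ x ∂volume, Γ x ≤ C * (1 + ‖x‖) ^ (-α)) →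
        ∀ f : EuclideanSpace ℝ (Fin 3) → EuclideanSpace ℝ (Fin 3), Measurable f →
          (∫⁻ x, ENNReal.ofReal (Γ x ^ (1 - q') * ‖f x‖ ^ q')) < ⊤ →
          MemLp f (ENNReal.ofReal (6 / 5)) volume ∧
          eLpNorm f (ENNReal.ofReal (6 / 5)) volume
            ≤ ENNReal.ofReal C'
              * (∫⁻ x, ENNReal.ofReal (Γ x ^ (1 - q') * ‖f x‖ ^ q')) ^ (1 / q') := by
  obtain ⟨r, hr, hK⟩ := exists_holder_exponent α q q' C hα0 hq2 hq6 hqα hq' hC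
  set K := eLpNorm (fun x : EuclideanSpace ℝ (Fin 3) => (C * (1 + ‖x‖) ^ (-α)) ^ (1 / q)) r volume
    with hKdef
  refine ⟨K.toReal + 1, by positivity, ?_⟩
  intro Γ hΓm hΓ0 hΓ f hf hI
  have hq0 : 0 < q := by linarith
  have hq1 : 0 < q - 1 := by linarith
  have hq'0 : 0 < q' := by rw [hq']; positivity
  have main : eLpNorm f (ENNReal.ofReal (6 / 5)) volume
            ≤ ENNReal.ofReal (K.toReal + 1)
              * (∫⁻ x, ENNReal.ofReal (Γ x ^ (1 - q') * ‖f x‖ ^ q')) ^ (1 / q') := by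
    set φ : EuclideanSpace ℝ (Fin 3) → ℝ := fun x => Γ x ^ (1 / q)
    set g : EuclideanSpace ℝ (Fin 3) → EuclideanSpace ℝ (Fin 3) :=
      fun x => (Γ x ^ (-(1 / q))) • f x
    have hφm : Measurable φ := hΓm.pow_const _
    have hgm : Measurable g := (hΓm.pow_const _).smul hf
    have hfg : f = φ • g := by
      ext1 x
      simp only [φ, g, Pi.smul_apply', smul_smul]
      rw [← Real.rpow_add (hΓ0 x)]
      simp
    have hφ : eLpNorm φ r volume ≤ K := by
      refine eLpNorm_mono_ae_real ?_
      filter_upwards [hΓ] with x hx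
      have h0 := hΓ0 x
      rw [Real.norm_of_nonneg (by positivity)]
      simp only [φ]
      gcongr
    have hg : eLpNorm g (ENNReal.ofReal q') volume
        = (∫⁻ x, ENNReal.ofReal (Γ x ^ (1 - q') * ‖f x‖ ^ q')) ^ (1 / q') := by
      rw [eLpNorm_eq_lintegral_rpow_enorm_toReal (by simpa using hq'0) (by simp),
        ENNReal.toReal_ofReal hq'0.le]
      congr 1
      refine lintegral_congr fun x => ?_
      have h0 := hΓ0 x
      rw [← ofReal_norm, ENNReal.ofReal_rpow_of_nonneg (by positivity) hq'0.le]
      simp only [g]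
      rw [norm_smul, Real.norm_of_nonneg (by positivity), Real.mul_rpow (by positivity) (by positivity),
        ← Real.rpow_mul h0.le]
      congr 3
      rw [hq']
      field_simp
      ring
    calc eLpNorm f (ENNReal.ofReal (6 / 5)) volume
        = eLpNorm (φ • g) (ENNReal.ofReal (6 / 5)) volume := by rw [← hfg]
      _ ≤ eLpNorm φ r volume * eLpNorm g (ENNReal.ofReal q') volume :=
        eLpNorm_smul_le_mul_eLpNorm hgm.aestronglyMeasurable hφm.aestronglyMeasurable
      _ ≤ _ := by
        rw [hg]
        gcongr
        refine hφ.trans ?_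
        rw [← ENNReal.ofReal_toReal hK.ne, ENNReal.toReal_ofReal (by positivity)]
        exact ENNReal.ofReal_le_ofReal (by linarith)
  refine ⟨⟨hf.aestronglyMeasurable, main.trans_lt ?_⟩, main⟩
  exact ENNReal.mul_lt_top (by simp) (ENNReal.rpow_lt_top_of_nonneg (by positivity) hI.ne)
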